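/- For every integer m ≥ 0 there exist real polynomials Q₁, Q₂ of degree at most m such that for all real x with 0 < x < 1/2 one has Σ_{k>0, k ≡ m (mod 2)} C(k+m, (k+m)/2) · x^k / k = Q₁(1/x) + Q₂(1/x)·√(1 − 4x²) − ε_m · C(m, m/2) · log(1 + √(1 − 4x²)), where ε_m = 1 if m is even and ε_m = 0 if m is odd. Moreover, if m is even then Q₁ and Q₂ are even polynomials and Q₂ has zero constant term, while if m is odd then Q₁ and Q₂ are odd polynomials. -/

import Mathlib

open Finset

theorem succ_mul_centralBinom_succ_real (n : ℕ) :
    ((n : ℝ) + 1) * (n + 1).centralBinom = 2 * (2 * n + 1) * n.centralBinom :=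
  mod_cast Nat.succ_mul_centralBinom_succ n

theorem multichoose_half_eq_centralBinom_div (n : ℕ) :
    Ring.multichoose (1 / 2 : ℝ) n = n.centralBinom / 4 ^ n := by
  induction n with
  | zero => simp
  | succ n ih =>
    have h₁ := Ring.factorial_nsmul_multichoose_eq_ascPochhammer (1 / 2 : ℝ) n
    have h₂ := Ring.factorial_nsmul_multichoose_eq_ascPochhammer (1 / 2 : ℝ) (n + 1)
    rw [ascPochhammer_succ_right, Polynomial.smeval_mul, ← h₁, ih, Nat.factorial_succ] at h₂
    have h₃ := succ_mul_centralBinom_succ_real n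
    simp only [nsmul_eq_mul, Polynomial.smeval_add, Polynomial.smeval_X, Polynomial.smeval_natCast] at h₂
    have h₄ : (n.factorial : ℝ) ≠ 0 := mod_cast n.factorial_ne_zero
    push_cast at h₂
    have h₅ : (n + 1 : ℝ) * Ring.multichoose (1 / 2 : ℝ) (n + 1)
        = (n + 1) * ((n + 1).centralBinom / 4 ^ (n + 1)) := by
      rw [← mul_div_assoc, h₃]
      apply mul_left_cancel₀ h₄
      rw [pow_succ]
      simp only [pow_one, pow_zero, mul_one] at h₂
      field_simp at h₂ ⊢
      linear_combination 2 * h₂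
    exact mul_left_cancel₀ (by positivity) h₅

/-- The generating function of the central binomial coefficients. -/
theorem hasSum_centralBinom_mul_pow {y : ℝ} (hy : |y| < 1 / 4) :
    HasSum (fun n : ℕ => (n.centralBinom : ℝ) * y ^ n) (√(1 - 4 * y))⁻¹ := by
  have h := (Real.one_div_one_sub_rpow_hasFPowerSeriesOnBall_zero (1 / 2)).hasSum
    (y := 4 * y) (by
      rw [Metric.mem_eball, edist_zero_right, ← ofReal_norm, ENNReal.ofReal_lt_one,
        Real.norm_eq_abs, abs_mul]
      norm_num
      linarith)
  have e : ∀ n : ℕ, Ring.choose ((1 / 2 : ℝ) + n - 1) n = n.centralBinom / 4 ^ n := fun n => by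
    rw [← multichoose_half_eq_centralBinom_div, Ring.choose]
    congr 1; ring
  simp only [FormalMultilinearSeries.ofScalars_apply_eq, e] at h
  rw [zero_add, ← Real.sqrt_eq_rpow, one_div] at h
  refine h.congr_fun fun n => ?_
  simp only [smul_eq_mul, mul_pow]
  field_simp

theorem hasSum_centralBinom_difference {y : ℝ} (hy : |y| < 1 / 4) :
    HasSum (fun n : ℕ => 4 * y * (n.centralBinom * y ^ n) - (n + 1).centralBinom * y ^ (n + 1))
      (1 - √(1 - 4 * y)) := by
  have h := hasSum_centralBinom_mul_pow hy
  have h₁ := (hasSum_nat_add_iff' 1).2 h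
  have hs : 0 < 1 - 4 * y := by linarith [(abs_lt.1 hy).2]
  have hs' := Real.sq_sqrt hs.le
  have hs₀ := (Real.sqrt_pos.2 hs).ne'
  convert! (h.mul_left (4 * y)).sub h₁ using 1
  simp only [range_one, sum_singleton, Nat.centralBinom_zero, Nat.cast_one, pow_zero, mul_one]
  field_simp
  linear_combination -hs'

theorem hasDerivAt_log_one_add_sqrt {y : ℝ} (hy : y < 1 / 4) :
    HasDerivAt (fun z => Real.log (1 + √(1 - 4 * z)))
      (-2 / (√(1 - 4 * y) * (1 + √(1 - 4 * y)))) y := by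
  have hs : 0 < √(1 - 4 * y) := Real.sqrt_pos.2 (by linarith)
  have h := ((((hasDerivAt_id y).const_mul 4).const_sub 1).sqrt (by simp; linarith)).const_add 1
  convert! h.log (by simp; positivity) using 1
  simp
  field_simp
  norm_num

theorem tsum_centralBinom_succ_mul_pow {y : ℝ} (hy : |y| < 1 / 4) :
    ∑' n : ℕ, ((n + 1).centralBinom : ℝ) * y ^ n / 2
      = 2 / (√(1 - 4 * y) * (1 + √(1 - 4 * y))) := by
  have hs₁ : 0 < 1 - 4 * y := by linarith [(abs_lt.1 hy).2]
  have hs : 0 < √(1 - 4 * y) := Real.sqrt_pos.2 hs₁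
  have hs' := Real.sq_sqrt hs₁.le
  rcases eq_or_ne y 0 with rfl | hy₀
  · rw [tsum_eq_single 0 fun n hn => by simp [hn]]
    norm_num [Nat.centralBinom, Nat.choose]
  · have h := ((hasSum_nat_add_iff' 1).2 (hasSum_centralBinom_mul_pow hy)).mul_left (1 / (2 * y))
    refine (h.congr_fun (g := fun n : ℕ => ((n + 1).centralBinom : ℝ) * y ^ n / 2)
      fun n => ?_).tsum_eq.trans ?_
    · rw [pow_succ]
      field_simp
    · simp only [range_one, sum_singleton, Nat.centralBinom_zero, Nat.cast_one, pow_zero, mul_one]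
      generalize √(1 - 4 * y) = s at *
      field_simp
      linear_combination -hs'

theorem hasSum_centralBinom_div {y : ℝ} (hy₀ : 0 ≤ y) (hy : y < 1 / 4) :
    HasSum (fun n : ℕ => ((n + 1).centralBinom : ℝ) * y ^ (n + 1) / (2 * (n + 1)))
      (Real.log 2 - Real.log (1 + √(1 - 4 * y))) := by
  obtain ⟨r, hyr, hr⟩ := exists_between hy
  have hr₀ : 0 < r := hy₀.trans_lt hyr
  have hsum : Summable fun n : ℕ => ((n + 1).centralBinom : ℝ) * r ^ n / 2 := by
    have h := (summable_nat_add_iff 1).2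
      (hasSum_centralBinom_mul_pow (y := r) (by rwa [abs_of_pos hr₀])).summable
    refine (h.mul_left (1 / (2 * r))).congr fun n => ?_
    rw [pow_succ]
    field_simp
  have hderiv : ∀ (n : ℕ), ∀ z ∈ Metric.ball (0 : ℝ) r,
      HasDerivAt (fun z : ℝ => ((n + 1).centralBinom : ℝ) * z ^ (n + 1) / (2 * (n + 1)))
        ((n + 1).centralBinom * z ^ n / 2) z := fun n z _ => by
    convert! (((hasDerivAt_pow (n + 1) z).const_mul ((n + 1).centralBinom : ℝ)).div_const
      (2 * (n + 1))) using 1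
    push_cast
    field_simp
  have hbound : ∀ (n : ℕ), ∀ z ∈ Metric.ball (0 : ℝ) r,
      ‖((n + 1).centralBinom : ℝ) * z ^ n / 2‖ ≤ (n + 1).centralBinom * r ^ n / 2 :=
    fun n z hz => by
    rw [mem_ball_zero_iff] at hz
    rw [norm_div, norm_mul, norm_pow, Real.norm_natCast, Real.norm_two]
    gcongr
  have h0 : Summable fun n : ℕ =>
      ((n + 1).centralBinom : ℝ) * (0 : ℝ) ^ (n + 1) / (2 * (n + 1)) := by simp [summable_zero]
  have hpre := (convex_ball (0 : ℝ) r).isPreconnected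
  have hzero : (0 : ℝ) ∈ Metric.ball (0 : ℝ) r := Metric.mem_ball_self hr₀
  have hymem : y ∈ Metric.ball (0 : ℝ) r := by
    rwa [mem_ball_zero_iff, Real.norm_eq_abs, abs_of_nonneg hy₀]
  have hF : ∀ z ∈ Metric.ball (0 : ℝ) r, HasDerivAt (fun z : ℝ =>
      (∑' n : ℕ, ((n + 1).centralBinom : ℝ) * z ^ (n + 1) / (2 * (n + 1)))
        + Real.log (1 + √(1 - 4 * z))) 0 z := fun z hz => by
    have hz' : |z| < 1 / 4 := (mem_ball_zero_iff.1 hz).trans hr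
    have h := (hasDerivAt_tsum_of_isPreconnected hsum Metric.isOpen_ball hpre hderiv hbound
      hzero h0 hz).add (hasDerivAt_log_one_add_sqrt (abs_lt.1 hz').2)
    rw [tsum_centralBinom_succ_mul_pow hz'] at h
    convert! h using 1
    ring
  have hconst := Metric.isOpen_ball.is_const_of_deriv_eq_zero hpre
    (fun z hz => (hF z hz).differentiableAt.differentiableWithinAt)
    (fun z hz => (hF z hz).deriv) hymem hzero
  have hs := summable_of_summable_hasDerivAt_of_isPreconnected hsum Metric.isOpen_ball hpre
    hderiv hbound hzero h0 hymem
  convert! hs.hasSum using 1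
  norm_num at hconst
  linarith

/-- Real polynomials of degree at most `m`, all of whose monomials have exponents of the
parity of `m`. -/
def parityPolynomials (m : ℕ) : Submodule ℝ (Polynomial ℝ) where
  carrier := {Q | ∀ i, ¬(i ≤ m ∧ i % 2 = m % 2) → Q.coeff i = 0}
  add_mem' hP hQ i hi := by rw [Polynomial.coeff_add, hP i hi, hQ i hi, add_zero]
  zero_mem' i _ := Polynomial.coeff_zero i
  smul_mem' c Q hQ i hi := by rw [Polynomial.coeff_smul, hQ i hi, smul_zero]

theorem X_pow_mem_parityPolynomials {m j : ℕ} (hj : j ≤ m) (h : j % 2 = m % 2) :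
    (Polynomial.X ^ j : Polynomial ℝ) ∈ parityPolynomials m := fun i hi => by
  rw [Polynomial.coeff_X_pow, if_neg]
  rintro rfl
  exact hi ⟨hj, h⟩

theorem parityPolynomials_le_add_two (m : ℕ) : parityPolynomials m ≤ parityPolynomials (m + 2) :=
  fun _ hQ i hi => hQ i (by lia)

theorem degree_le_of_mem_parityPolynomials {m : ℕ} {Q : Polynomial ℝ}
    (hQ : Q ∈ parityPolynomials m) : Q.degree ≤ m :=
  (Polynomial.degree_le_iff_coeff_zero _ _).2 fun i hi =>
    hQ i fun h => absurd (Nat.cast_lt.1 hi) (by lia)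

/-- The coefficient of the logarithm in the closed form. -/
noncomputable def logCoeff (m : ℕ) : ℝ := if Even m then ((m.choose (m / 2) : ℕ) : ℝ) else 0

theorem logCoeff_add_two (m : ℕ) :
    ((m : ℝ) + 2) * logCoeff (m + 2) = 4 * (m + 1) * logCoeff m := by
  rcases Nat.even_or_odd m with h | h
  · have h' : Even (m + 2) := h.add even_two
    rw [logCoeff, logCoeff, if_pos h, if_pos h']
    obtain ⟨r, rfl⟩ := h
    have e := succ_mul_centralBinom_succ_real r
    rw [Nat.centralBinom, Nat.centralBinom] at e
    rw [show (r + r + 2) / 2 = r + 1 by lia, show (r + r) / 2 = r by lia,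
      show r + r + 2 = 2 * (r + 1) by ring, show r + r = 2 * r by ring]
    push_cast
    linear_combination 2 * e
  · have h' : Odd (m + 2) := h.add_even even_two
    rw [logCoeff, logCoeff, if_neg (Nat.not_even_iff_odd.2 h), if_neg (Nat.not_even_iff_odd.2 h')]
    ring

theorem centralBinom_div_recurrence (m n : ℕ) (h : m < 2 * n) (y : ℝ) :
    ((n + 1).centralBinom : ℝ) * y ^ (n + 1) / (2 * (n + 1 : ℕ) - (m + 2 : ℕ))
      = (4 * y * (n.centralBinom * y ^ n) - (n + 1).centralBinom * y ^ (n + 1)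
        + 4 * (m + 1) * y * (n.centralBinom * y ^ n / (2 * n - m))) / (m + 2) := by
  have e := succ_mul_centralBinom_succ_real n
  have h' : (0 : ℝ) < 2 * n - m := by
    have : (m : ℝ) < 2 * n := mod_cast h
    linarith
  have h'' : (2 * (n + 1 : ℕ) - (m + 2 : ℕ) : ℝ) = 2 * n - m := by push_cast; ring
  rw [h'']
  have h₃ := h'.ne'
  have h₄ : (m : ℝ) + 2 ≠ 0 := by positivity
  field_simp
  rw [pow_succ]
  linear_combination 2 * y ^ n * y * e

theorem exists_hasSum_centralBinom_div (m : ℕ) :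
    ∃ Q₁ ∈ parityPolynomials m, ∃ Q₂ ∈ parityPolynomials m, Q₂.coeff 0 = 0 ∧
      ∀ x : ℝ, 0 < x → x < 1 / 2 →
        HasSum (fun i : ℕ => ((i + (m / 2 + 1)).centralBinom : ℝ) * (x ^ 2) ^ (i + (m / 2 + 1))
            / (2 * (i + (m / 2 + 1) : ℕ) - m))
          (x ^ m * (Q₁.eval (1 / x) + Q₂.eval (1 / x) * √(1 - 4 * x ^ 2)
            - logCoeff m * Real.log (1 + √(1 - 4 * x ^ 2)))) := by
  have sq_lt : ∀ x : ℝ, 0 < x → x < 1 / 2 → x ^ 2 < 1 / 4 := fun x hx hx' => by nlinarith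
  induction m using Nat.twoStepInduction with
  | zero =>
    refine ⟨Real.log 2 • Polynomial.X ^ 0,
      Submodule.smul_mem _ _ (X_pow_mem_parityPolynomials le_rfl rfl), 0, zero_mem _, by simp,
      fun x hx hx' => ?_⟩
    convert! hasSum_centralBinom_div (sq_nonneg x) (sq_lt x hx hx') using 1
    · ext n; simp
    · simp [logCoeff]
  | one =>
    refine ⟨Polynomial.X ^ 1, X_pow_mem_parityPolynomials le_rfl rfl, -Polynomial.X ^ 1,
      neg_mem (X_pow_mem_parityPolynomials le_rfl rfl), by simp, fun x hx hx' => ?_⟩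
    convert! hasSum_centralBinom_difference
      (y := x ^ 2) (by rw [abs_of_pos (by positivity)]; exact sq_lt x hx hx') using 1
    · ext n
      have e := succ_mul_centralBinom_succ_real n
      have h : (2 * ((n : ℝ) + 1) - 1) ≠ 0 := by
        have : (0 : ℝ) ≤ n := n.cast_nonneg
        linarith
      simp only [Nat.reduceDiv, zero_add, Nat.cast_add, Nat.cast_one]
      field_simp
      rw [pow_succ]
      linear_combination 2 * (x ^ 2) ^ n * x ^ 2 * e
    · simp [logCoeff]
      field_simp
      ring
  | more m ih _ =>
    obtain ⟨Q₁, hQ₁, Q₂, hQ₂, hQ₂', h⟩ := ih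
    have hX : (Polynomial.X ^ (m + 2) : Polynomial ℝ) ∈ parityPolynomials (m + 2) :=
      X_pow_mem_parityPolynomials le_rfl rfl
    let R : Polynomial ℝ := ∑ n ∈ range (m / 2 + 1),
      (4 * n.centralBinom - (n + 1).centralBinom : ℝ) • Polynomial.X ^ (m - 2 * n)
    have hR : R ∈ parityPolynomials (m + 2) := sum_mem fun n hn =>
      Submodule.smul_mem _ _ (X_pow_mem_parityPolynomials (by lia) (by
        have := mem_range.1 hn
        lia))
    refine ⟨((m : ℝ) + 2)⁻¹ • (Polynomial.X ^ (m + 2) - R + (4 * (m + 1) : ℝ) • Q₁), ?_,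
      ((m : ℝ) + 2)⁻¹ • (-Polynomial.X ^ (m + 2) + (4 * (m + 1) : ℝ) • Q₂), ?_, ?_, ?_⟩
    · exact Submodule.smul_mem _ _ (add_mem (sub_mem hX hR)
        (Submodule.smul_mem _ _ (parityPolynomials_le_add_two m hQ₁)))
    · exact Submodule.smul_mem _ _ (add_mem (neg_mem hX)
        (Submodule.smul_mem _ _ (parityPolynomials_le_add_two m hQ₂)))
    · simp [hQ₂']
    · intro x hx hx'
      have hd := (hasSum_nat_add_iff' (m / 2 + 1)).2 (hasSum_centralBinom_difference
        (y := x ^ 2) (by rw [abs_of_pos (by positivity)]; exact sq_lt x hx hx'))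
      have hs := (hd.add ((h x hx hx').mul_left (4 * (m + 1) * x ^ 2))).div_const ((m : ℝ) + 2)
      have hN : (m + 2) / 2 + 1 = m / 2 + 1 + 1 := by lia
      have hReval : x ^ (m + 2) * R.eval (1 / x) = ∑ n ∈ range (m / 2 + 1),
          (4 * x ^ 2 * (n.centralBinom * (x ^ 2) ^ n)
            - (n + 1).centralBinom * (x ^ 2) ^ (n + 1)) := by
        rw [Polynomial.eval_finsetSum, mul_sum]
        refine sum_congr rfl fun n hn => ?_
        have hn' : m + 2 = 2 * (n + 1) + (m - 2 * n) := by
          have := mem_range.1 hn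
          lia
        rw [hn', pow_add, Polynomial.eval_smul, Polynomial.eval_pow, Polynomial.eval_X,
          smul_eq_mul, one_div_pow, ← pow_mul, ← pow_mul]
        field_simp
        ring
      convert! hs using 1
      · ext i
        rw [hN]
        exact centralBinom_div_recurrence m (i + (m / 2 + 1)) (by lia) (x ^ 2)
      · have hL := logCoeff_add_two m
        rw [← hReval]
        have hxm : x ^ (m + 2) * (1 / x) ^ (m + 2) = 1 := by
          rw [← mul_pow, mul_one_div_cancel hx.ne', one_pow]
        have h₂ : (m : ℝ) + 2 ≠ 0 := by positivity
        have hL' : logCoeff (m + 2) = 4 * (m + 1) * logCoeff m / (m + 2) := by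
          rw [← hL]; field_simp
        rw [hL']
        simp only [Polynomial.eval_smul, Polynomial.eval_add, Polynomial.eval_sub,
          Polynomial.eval_neg, Polynomial.eval_pow, Polynomial.eval_X, smul_eq_mul]
        rw [eq_div_iff h₂]
        generalize (1 / x) ^ (m + 2) = u at *
        generalize √(1 - 4 * x ^ 2) = s
        field_simp
        rw [pow_add] at hxm ⊢
        linear_combination (1 - s) * hxm

/-- For every `m ≥ 0` there exist real polynomials `Q₁, Q₂` of degree at
most `m` such that for all `0 < x < 1/2`,
`Σ_{k>0, k ≡ m (2)} C(k+m, (k+m)/2)·x^k/k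
  = Q₁(1/x) + Q₂(1/x)·√(1−4x²) − ε_m·C(m, m/2)·log(1+√(1−4x²))`,
where `ε_m = 1` for even `m` and `ε_m = 0` for odd `m`.  Moreover if `m` is even then
`Q₁, Q₂` are even polynomials and `Q₂` has zero constant term, while if `m` is odd then
`Q₁, Q₂` are odd polynomials. -/
theorem combinatorial_series_closed_form (m : ℕ) :
    ∃ Q₁ Q₂ : Polynomial ℝ,
      Q₁.degree ≤ m ∧ Q₂.degree ≤ m ∧
      (∀ x : ℝ, 0 < x → x < 1 / 2 →
        (Summable fun k : ℕ =>
          if k % 2 = m % 2 ∧ 0 < k then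
            (((k + m).choose ((k + m) / 2) : ℕ) : ℝ) * x ^ k / k else 0) ∧
        (∑' k : ℕ,
            if k % 2 = m % 2 ∧ 0 < k then
              (((k + m).choose ((k + m) / 2) : ℕ) : ℝ) * x ^ k / k else 0)
          = Q₁.eval (1 / x) + Q₂.eval (1 / x) * Real.sqrt (1 - 4 * x ^ 2)
            - (if Even m then ((m.choose (m / 2) : ℕ) : ℝ) else 0) *
                Real.log (1 + Real.sqrt (1 - 4 * x ^ 2))) ∧
      (Even m →
        (∀ i, Odd i → Q₁.coeff i = 0) ∧ (∀ i, Odd i → Q₂.coeff i = 0) ∧ Q₂.coeff 0 = 0) ∧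
      (Odd m →
        (∀ i, Even i → Q₁.coeff i = 0) ∧ (∀ i, Even i → Q₂.coeff i = 0)) := by

  obtain ⟨Q₁, hQ₁, Q₂, hQ₂, hQ₂', h⟩ := exists_hasSum_centralBinom_div m
  refine ⟨Q₁, Q₂, degree_le_of_mem_parityPolynomials hQ₁, degree_le_of_mem_parityPolynomials hQ₂,
    fun x hx hx' => ?_, fun hm => ⟨fun i hi => hQ₁ i ?_, fun i hi => hQ₂ i ?_, hQ₂'⟩,
    fun hm => ⟨fun i hi => hQ₁ i ?_, fun i hi => hQ₂ i ?_⟩⟩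
  · suffices H : HasSum (fun k : ℕ => if k % 2 = m % 2 ∧ 0 < k then
        (((k + m).choose ((k + m) / 2) : ℕ) : ℝ) * x ^ k / k else 0) _ from
      ⟨H.summable, H.tsum_eq⟩
    have hinj : Function.Injective fun i : ℕ => 2 * (i + (m / 2 + 1)) - m := fun i j hij => by
      simp only at hij
      lia
    rw [← hinj.hasSum_iff]
    · have hs := (h x hx hx').mul_left (x ^ m)⁻¹
      rw [inv_mul_cancel_left₀ (by positivity)] at hs
      refine hs.congr_fun fun i => ?_
      obtain ⟨k, hk⟩ : ∃ k, k + m = 2 * (i + (m / 2 + 1)) :=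
        ⟨2 * (i + (m / 2 + 1)) - m, by lia⟩
      have hk' : 2 * (i + (m / 2 + 1)) - m = k := by lia
      have hcast : (2 * (i + (m / 2 + 1) : ℕ) - m : ℝ) = k := by
        have : (k + m : ℝ) = 2 * (i + (m / 2 + 1) : ℕ) := mod_cast hk
        linarith
      rw [Function.comp_apply, hk', if_pos ⟨by lia, by lia⟩, hcast, hk,
        Nat.mul_div_cancel_left _ two_pos, ← pow_mul, ← hk, pow_add, Nat.centralBinom, ← hk]
      field_simp
    · intro k hk
      refine if_neg fun hk' => hk ⟨(k + m) / 2 - (m / 2 + 1), ?_⟩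
      simp only
      lia
  all_goals
    rw [Nat.odd_iff, Nat.even_iff] at *
    lia
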